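/- Let w be a weight function with decay rate ω, t ∈ ℝ, n ≥ 1 an integer, fix Δ ∈ (0, ω/2) and ε ∈ (0, ω/2), and let J_{t,n}(λ, μ) be the associated kernel. Then: (i) for each fixed μ in S_ε \ Γ_β, the function λ ↦ J_{t,n}(λ, μ) is analytic on S_ε \ Γ_β; (ii) for each fixed λ in S_ε \ Γ_β, the function μ ↦ J_{t,n}(λ, μ) is analytic on S_ε \ Γ_β; here S_ε := {ζ ∈ ℂ : |Im ζ| < ω/2 − ε} and Γ_β := {ζ ∈ ℂ : Im ζ = −Δ}. -/

import Mathlib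

open MeasureTheory

/-- The phase `ψ_n(λ, z) = λ^(2n+1)/(2n+1) + z·λ`. -/
noncomputable def psiC (n : ℕ) (lam z : ℂ) : ℂ := lam ^ (2*n+1) / (2*(n:ℂ)+1) + z * lam

/-- The Fourier–Stieltjes transform `F(ζ) = ∫_ℝ e^{izζ}·w'(z) dz`. -/
noncomputable def FwC (w : ℝ → ℝ) (zeta : ℂ) : ℂ :=
  ∫ z : ℝ, Complex.exp (Complex.I * (z:ℂ) * zeta) * ((deriv w z : ℝ) : ℂ)

/-- The kernel
`J_{t,n}(λ, μ) = (1/(2π)²)·exp((i/2)ψ_n(λ,2t) + (i/2)ψ_n(μ,0))·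
  ∫_ℝ exp(−iψ_n(u−iΔ,t))·F(λ−u+iΔ) / ((λ−u+iΔ)(u−iΔ−μ)) du`. -/
noncomputable def Jker (w : ℝ → ℝ) (t : ℝ) (n : ℕ) (Δ : ℝ) (lam mu : ℂ) : ℂ :=
  ((1 / (2*Real.pi)^2 : ℝ) : ℂ) *
    Complex.exp ((Complex.I/2) * psiC n lam ((2*t : ℝ) : ℂ) + (Complex.I/2) * psiC n mu 0) *
    ∫ u : ℝ, Complex.exp (-Complex.I * psiC n ((u:ℂ) - Complex.I * (Δ:ℂ)) ((t:ℝ):ℂ)) *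
        FwC w (lam - (u:ℂ) + Complex.I * (Δ:ℂ)) /
        ((lam - (u:ℂ) + Complex.I * (Δ:ℂ)) * ((u:ℂ) - Complex.I * (Δ:ℂ) - mu))

open Filter Topology Metric in
/-- A dominated parameter integral of holomorphic functions is holomorphic. -/
theorem differentiableOn_integral_of_locally_dominated {α : Type*} [MeasurableSpace α]
    {ν : Measure α} {U : Set ℂ} (hU : IsOpen U) {f : ℂ → α → ℂ}
    (hmeas : ∀ z ∈ U, AEStronglyMeasurable (f z) ν)
    (hdiff : ∀ a, DifferentiableOn ℂ (fun z => f z a) U)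
    (hbound : ∀ z₀ ∈ U, ∃ s ∈ 𝓝 z₀, ∃ g : α → ℝ, Integrable g ν ∧ ∀ z ∈ s, ∀ a, ‖f z a‖ ≤ g a) :
    DifferentiableOn ℂ (fun z => ∫ a, f z a ∂ν) U := by
  intro z₀ hz₀
  obtain ⟨s, hs, g, hg, hfg⟩ := hbound z₀ hz₀
  obtain ⟨r, hr, hrs⟩ := Metric.mem_nhds_iff.1 (Filter.inter_mem hs (hU.mem_nhds hz₀))
  have hsub : ∀ z ∈ ball z₀ (r / 2), closedBall z (r / 2) ⊆ ball z₀ r := by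
    intro z hz y hy
    rw [mem_ball] at hz ⊢
    rw [mem_closedBall] at hy
    linarith [dist_triangle y z z₀]
  have hball : ∀ z ∈ ball z₀ (r / 2), z ∈ U := fun z hz =>
    (hrs (ball_subset_ball (by linarith) hz)).2
  have hder : ∀ z ∈ ball z₀ (r / 2), ∀ a, HasDerivAt (fun z => f z a) (deriv (fun z => f z a) z) z :=
    fun z hz a => ((hdiff a).differentiableAt (hU.mem_nhds (hball z hz))).hasDerivAt
  have hz₀_mem : z₀ ∈ ball z₀ (r / 2) := mem_ball_self (by linarith)
  have hderiv_meas : AEStronglyMeasurable (fun a => deriv (fun z => f z a) z₀) ν := by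
    have hlim : ∀ a, Tendsto (fun h : ℂ => h⁻¹ • (f (z₀ + h) a - f z₀ a)) (𝓝[≠] 0)
        (𝓝 (deriv (fun z => f z a) z₀)) := fun a =>
      (hder z₀ hz₀_mem a).tendsto_slope_zero
    have hadd : Tendsto (fun h : ℂ => z₀ + h) (𝓝[≠] 0) (𝓝 z₀) := by
      have : Tendsto (fun h : ℂ => z₀ + h) (𝓝 0) (𝓝 (z₀ + 0)) :=
        (continuous_const.add continuous_id).tendsto 0
      rw [add_zero] at this
      exact this.mono_left nhdsWithin_le_nhds
    have hev : ∀ᶠ h in 𝓝[≠] (0 : ℂ), z₀ + h ∈ U := hadd (hU.mem_nhds hz₀)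
    obtain ⟨v, hv⟩ := exists_seq_tendsto (𝓝[≠] (0 : ℂ))
    obtain ⟨N, hN⟩ := eventually_atTop.1 (hv.eventually hev)
    refine aestronglyMeasurable_of_tendsto_ae atTop
      (f := fun k a => (v (k + N))⁻¹ • (f (z₀ + v (k + N)) a - f z₀ a)) (fun k => ?_) ?_
    · have hk := hmeas _ (hN (k + N) (Nat.le_add_left N k))
      exact (hk.sub (hmeas _ hz₀)).const_smul (v (k + N))⁻¹
    · exact ae_of_all _ fun a => (hlim a).comp (hv.comp (tendsto_add_atTop_nat N))
  have hderiv_le : ∀ a, ∀ z ∈ ball z₀ (r / 2), ‖deriv (fun z => f z a) z‖ ≤ g a / (r / 2) := by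
    intro a z hz
    refine Complex.norm_deriv_le_of_forall_mem_sphere_norm_le (half_pos hr) ?_ fun y hy =>
      hfg y (hrs (hsub z hz (sphere_subset_closedBall hy))).1 a
    exact (hdiff a).diffContOnCl_ball fun y hy => (hrs (hsub z hz hy)).2
  have h_int : Integrable (f z₀) ν :=
    hg.mono' (hmeas z₀ hz₀) (ae_of_all _ fun a => hfg z₀ (mem_of_mem_nhds hs) a)
  have key := hasDerivAt_integral_of_dominated_loc_of_deriv_le (F := f)
    (F' := fun z a => deriv (fun z => f z a) z) (bound := fun a => g a / (r / 2))
    (ball_mem_nhds z₀ (half_pos hr)) (eventually_of_mem (hU.mem_nhds hz₀) hmeas) h_int hderiv_meas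
    (ae_of_all _ hderiv_le) (hg.div_const _) (ae_of_all _ fun a z hz => hder z hz a)
  exact key.2.differentiableAt.differentiableWithinAt

theorem integrable_exp_neg_mul_abs {b : ℝ} (hb : 0 < b) :
    Integrable fun x : ℝ => Real.exp (-b * |x|) := by
  rw [← integrableOn_univ, ← Set.Iic_union_Ioi (a := (0 : ℝ)), integrableOn_union]
  constructor
  · refine (integrableOn_exp_mul_Iic hb 0).congr_fun (fun x hx => ?_) measurableSet_Iic
    simp [abs_of_nonpos (Set.mem_Iic.1 hx)]
  · refine (integrableOn_exp_mul_Ioi (neg_neg_of_pos hb) 0).congr_fun (fun x hx => ?_)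
      measurableSet_Ioi
    simp [abs_of_pos (Set.mem_Ioi.1 hx)]

open Filter in
/-- A nonnegative derivative decaying like `e^{-ω|x|}` has exponential moments of order `a < ω`. -/
theorem integrable_exp_mul_abs_mul_deriv {w : ℝ → ℝ} (hw : Differentiable ℝ w)
    (hpos : ∀ x, 0 ≤ deriv w x) {ω x₀ : ℝ}
    (hdecay : ∀ x : ℝ, x₀ ≤ |x| → deriv w x ≤ Real.exp (-ω * |x|)) {a : ℝ} (ha : a < ω) :
    Integrable fun x : ℝ => Real.exp (a * |x|) * deriv w x := by
  have hloc : LocallyIntegrable (deriv w) := by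
    refine fun x => ⟨Set.Icc (x - 1) (x + 1), Icc_mem_nhds (by linarith) (by linarith), ?_⟩
    rw [integrableOn_Icc_iff_integrableOn_Ioc]
    exact intervalIntegral.integrableOn_deriv_of_nonneg hw.continuous.continuousOn
      (fun y _ => (hw y).hasDerivAt) fun y _ => hpos y
  have hloc' : LocallyIntegrable fun x : ℝ => Real.exp (a * |x|) * deriv w x := by
    have hc : Continuous fun x : ℝ => Real.exp (a * |x|) := by fun_prop
    rw [← locallyIntegrableOn_univ] at hloc ⊢
    exact hloc.continuousOn_mul hc.continuousOn isOpen_univ.isLocallyClosed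
  refine hloc'.integrable_of_isBigO_cocompact (g := fun x : ℝ => Real.exp (-(ω - a) * |x|)) ?_
    ((integrable_exp_neg_mul_abs (sub_pos.2 ha)).integrableAtFilter _)
  refine Asymptotics.IsBigO.of_bound 1 ?_
  have habs : Tendsto (fun x : ℝ => |x|) (cocompact ℝ) atTop := tendsto_norm_cocompact_atTop
  filter_upwards [habs.eventually_ge_atTop x₀] with x hx
  rw [Real.norm_of_nonneg (mul_nonneg (Real.exp_pos _).le (hpos x)), Real.norm_of_nonneg
    (Real.exp_pos _).le, one_mul]
  calc Real.exp (a * |x|) * deriv w x ≤ Real.exp (a * |x|) * Real.exp (-ω * |x|) := by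
        gcongr; exact hdecay x hx
    _ = Real.exp (-(ω - a) * |x|) := by rw [← Real.exp_add]; ring_nf

theorem norm_FwC_integrand_le {w : ℝ → ℝ} (hpos : ∀ x, 0 ≤ deriv w x) {a : ℝ} {ζ : ℂ}
    (hζ : |ζ.im| ≤ a) (x : ℝ) :
    ‖Complex.exp (Complex.I * (x : ℂ) * ζ) * ((deriv w x : ℝ) : ℂ)‖ ≤
      Real.exp (a * |x|) * deriv w x := by
  rw [norm_mul, Complex.norm_exp, Complex.norm_real, Real.norm_of_nonneg (hpos x)]
  refine mul_le_mul_of_nonneg_right (Real.exp_le_exp.2 ?_) (hpos x)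
  have : (Complex.I * (x : ℂ) * ζ).re = -(x * ζ.im) := by simp
  rw [this]
  calc -(x * ζ.im) ≤ |x * ζ.im| := neg_le_abs _
    _ = |ζ.im| * |x| := by rw [abs_mul, mul_comm]
    _ ≤ a * |x| := by gcongr

theorem norm_FwC_le {w : ℝ → ℝ} (hpos : ∀ x, 0 ≤ deriv w x) {a : ℝ}
    (h_int : Integrable fun x : ℝ => Real.exp (a * |x|) * deriv w x) {ζ : ℂ} (hζ : |ζ.im| ≤ a) :
    ‖FwC w ζ‖ ≤ ∫ x : ℝ, Real.exp (a * |x|) * deriv w x :=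
  norm_integral_le_of_norm_le h_int (ae_of_all _ (norm_FwC_integrand_le hpos hζ))

theorem isOpen_abs_im_lt (a : ℝ) : IsOpen {ζ : ℂ | |ζ.im| < a} :=
  isOpen_lt (by fun_prop) continuous_const

theorem differentiableOn_FwC {w : ℝ → ℝ} (hpos : ∀ x, 0 ≤ deriv w x) {a : ℝ}
    (h_int : Integrable fun x : ℝ => Real.exp (a * |x|) * deriv w x) :
    DifferentiableOn ℂ (FwC w) {ζ : ℂ | |ζ.im| < a} := by
  refine differentiableOn_integral_of_locally_dominated (isOpen_abs_im_lt a) (fun ζ _ => ?_)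
    (fun x => ?_) fun ζ hζ => ⟨_, (isOpen_abs_im_lt a).mem_nhds hζ, _, h_int,
      fun z hz x => norm_FwC_integrand_le hpos (le_of_lt hz) x⟩
  · exact (by fun_prop : Continuous fun x : ℝ => Complex.exp (Complex.I * (x : ℂ) * ζ))
      |>.aestronglyMeasurable.mul
        (Complex.measurable_ofReal.comp (measurable_deriv w)).aestronglyMeasurable
  · fun_prop

open Filter Topology in
theorem tendsto_im_sub_pow_div (Δ : ℝ) (m : ℕ) :
    Tendsto (fun u : ℝ => (((u : ℂ) - Complex.I * (Δ : ℂ)) ^ (m + 1)).im / u ^ m)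
      (cocompact ℝ) (𝓝 (-((m + 1) * Δ))) := by
  have hd : HasDerivAt (fun x : ℂ => (1 - Complex.I * Δ * x) ^ (m + 1))
      (-((m + 1) * (Complex.I * Δ))) ((0 : ℝ) : ℂ) := by
    refine ((((hasDerivAt_id ((0 : ℝ) : ℂ)).const_mul (Complex.I * Δ)).const_sub 1).fun_pow
      (m + 1)).congr_deriv ?_
    simp
  have him : HasDerivAt (fun x : ℝ => ((1 - Complex.I * Δ * (x : ℂ)) ^ (m + 1)).im)
      (-((m + 1) * Δ)) 0 := by
    refine (Complex.imCLM.hasFDerivAt.comp_hasDerivAt (0 : ℝ) hd.comp_ofReal).congr_deriv ?_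
    simp
  have hinv : Tendsto (fun u : ℝ => u⁻¹) (cocompact ℝ) (𝓝[≠] 0) := by
    refine tendsto_nhdsWithin_iff.2 ⟨?_, ?_⟩
    · rw [← Metric.cobounded_eq_cocompact]
      exact tendsto_inv₀_cobounded
    · filter_upwards [(tendsto_norm_cocompact_atTop (E := ℝ)).eventually_gt_atTop 0] with u hu
      simpa using hu
  refine (him.tendsto_slope_zero.comp hinv).congr' ?_
  filter_upwards [(tendsto_norm_cocompact_atTop (E := ℝ)).eventually_gt_atTop 0] with u hu
  have hu0 : u ≠ 0 := norm_pos_iff.1 hu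
  have huC : (u : ℂ) ≠ 0 := by exact_mod_cast hu0
  have hfac : ((u : ℂ) - Complex.I * Δ) ^ (m + 1) =
      ((u ^ (m + 1) : ℝ) : ℂ) * (1 - Complex.I * Δ * ((u⁻¹ : ℝ) : ℂ)) ^ (m + 1) := by
    push_cast
    rw [← mul_pow]
    congr 1
    field_simp
  have hone : ((1 : ℂ) ^ (m + 1)).im = 0 := by simp
  simp only [Function.comp_apply, zero_add, Complex.ofReal_zero, mul_zero, sub_zero, hone,
    smul_eq_mul, inv_inv]
  rw [hfac, Complex.im_ofReal_mul]
  generalize ((1 - Complex.I * (Δ : ℂ) * ((u⁻¹ : ℝ) : ℂ)) ^ (m + 1)).im = c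
  rw [pow_succ]
  field_simp

open Filter in
/-- The oscillatory factor decays like a Gaussian along the line `ℝ - iΔ`. -/
theorem integrable_exp_psiC (t : ℝ) {n : ℕ} (hn : 1 ≤ n) {Δ : ℝ} (hΔ : 0 < Δ) :
    Integrable fun u : ℝ =>
      Complex.exp (-Complex.I * psiC n ((u : ℂ) - Complex.I * (Δ : ℂ)) ((t : ℝ) : ℂ)) := by
  have hcont : Continuous fun u : ℝ =>
      Complex.exp (-Complex.I * psiC n ((u : ℂ) - Complex.I * (Δ : ℂ)) ((t : ℝ) : ℂ)) := by
    unfold psiC; fun_prop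
  refine hcont.locallyIntegrable.integrable_of_isBigO_cocompact
    (g := fun u : ℝ => Real.exp (-(Δ / 2) * u ^ 2)) ?_
    ((integrable_exp_neg_mul_sq (half_pos hΔ)).integrableAtFilter _)
  refine Asymptotics.IsBigO.of_bound (Real.exp (-(t * Δ))) ?_
  have hpos : (0 : ℝ) < 2 * n + 1 := by positivity
  have hlim := tendsto_im_sub_pow_div Δ (2 * n)
  have hlt : -(((2 * n : ℕ) + 1 : ℝ) * Δ) < -((2 * n + 1) * (Δ / 2)) := by
    push_cast; nlinarith
  filter_upwards [hlim.eventually_lt_const hlt,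
    (tendsto_norm_cocompact_atTop (E := ℝ)).eventually_ge_atTop 1] with u hu hu1
  have hsq : 1 ≤ u ^ 2 := by
    rw [Real.norm_eq_abs] at hu1
    nlinarith [sq_abs u]
  have hpow : u ^ 2 ≤ u ^ (2 * n) := by
    rw [pow_mul]
    exact le_self_pow₀ hsq (by omega)
  have him : (((u : ℂ) - Complex.I * Δ) ^ (2 * n + 1)).im ≤
      -((2 * n + 1) * (Δ / 2)) * u ^ 2 := by
    rw [div_lt_iff₀ (by linarith)] at hu
    refine hu.le.trans (mul_le_mul_of_nonpos_left hpow ?_)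
    nlinarith
  have hre : (-Complex.I * psiC n ((u : ℂ) - Complex.I * (Δ : ℂ)) ((t : ℝ) : ℂ)).re =
      (((u : ℂ) - Complex.I * Δ) ^ (2 * n + 1)).im / (2 * n + 1) - t * Δ := by
    have hcast : (2 * (n : ℂ) + 1) = ((2 * n + 1 : ℝ) : ℂ) := by push_cast; rfl
    unfold psiC
    rw [hcast]
    simp only [neg_mul, Complex.neg_re, Complex.I_mul_re, Complex.add_im, Complex.div_ofReal_im,
      Complex.im_ofReal_mul, Complex.sub_im, Complex.ofReal_im, Complex.I_mul_im,
      Complex.ofReal_re]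
    ring
  rw [Complex.norm_exp, hre, Real.norm_of_nonneg (Real.exp_pos _).le, ← Real.exp_add,
    Real.exp_le_exp]
  have : (((u : ℂ) - Complex.I * Δ) ^ (2 * n + 1)).im / (2 * n + 1) ≤ -(Δ / 2) * u ^ 2 := by
    rw [div_le_iff₀ hpos]
    linarith
  linarith

theorem norm_Jker_integrand_le {E F p q : ℂ} {C d e : ℝ} (hd : 0 < d) (he : 0 < e)
    (hF : ‖F‖ ≤ C) (hp : d ≤ |p.im|) (hq : e ≤ |q.im|) :
    ‖E * F / (p * q)‖ ≤ ‖E‖ * (C / (d * e)) := by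
  rw [norm_div, norm_mul, norm_mul, mul_div_assoc]
  have hC : 0 ≤ C := (norm_nonneg F).trans hF
  gcongr
  · exact hp.trans (Complex.abs_im_le_norm p)
  · exact hq.trans (Complex.abs_im_le_norm q)

/-- the kernel `J_{t,n}(λ, μ)` is separately analytic in each variable on
`S_ε \ Γ_β`, where `S_ε = {|Im ζ| < ω/2 − ε}` and `Γ_β = {Im ζ = −Δ}`. -/
theorem Jker_separately_analytic
    (w : ℝ → ℝ) (hw_diff : Differentiable ℝ w)
    (hw_pos : ∀ x, 0 < deriv w x)
    (hw_top : Filter.Tendsto w Filter.atTop (nhds 1))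
    (hw_bot : Filter.Tendsto w Filter.atBot (nhds 0))
    (ω x₀ : ℝ) (hω : 0 < ω) (hx₀ : 0 < x₀)
    (hw_decay : ∀ x : ℝ, x₀ ≤ |x| → deriv w x ≤ Real.exp (-ω * |x|))
    (t : ℝ) (n : ℕ) (hn : 1 ≤ n)
    (Δ : ℝ) (hΔ : 0 < Δ) (hΔω : Δ < ω/2)
    (ε : ℝ) (hε : 0 < ε) (hεω : ε < ω/2) :
    (∀ mu : ℂ, mu ∈ ({zeta : ℂ | |zeta.im| < ω/2 - ε} \ {zeta : ℂ | zeta.im = -Δ}) →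
      DifferentiableOn ℂ (fun lam : ℂ => Jker w t n Δ lam mu)
        ({zeta : ℂ | |zeta.im| < ω/2 - ε} \ {zeta : ℂ | zeta.im = -Δ}))
    ∧ (∀ lam : ℂ, lam ∈ ({zeta : ℂ | |zeta.im| < ω/2 - ε} \ {zeta : ℂ | zeta.im = -Δ}) →
      DifferentiableOn ℂ (fun mu : ℂ => Jker w t n Δ lam mu)
        ({zeta : ℂ | |zeta.im| < ω/2 - ε} \ {zeta : ℂ | zeta.im = -Δ})) := by
  have hpos : ∀ x, 0 ≤ deriv w x := fun x => (hw_pos x).le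
  have h_int := integrable_exp_mul_abs_mul_deriv hw_diff hpos hw_decay (show ω - ε < ω by linarith)
  have hF := differentiableOn_FwC hpos h_int
  have hFle := fun ζ hζ => norm_FwC_le hpos h_int (ζ := ζ) hζ
  set C := ∫ x : ℝ, Real.exp ((ω - ε) * |x|) * deriv w x
  have hE := integrable_exp_psiC t hn hΔ
  set U := {zeta : ℂ | |zeta.im| < ω/2 - ε} \ {zeta : ℂ | zeta.im = -Δ} with hU_def
  have hU : IsOpen U := (isOpen_abs_im_lt _).sdiff
    (isClosed_eq Complex.continuous_im continuous_const)
  have him₁ : ∀ (z : ℂ) (u : ℝ), (z - (u : ℂ) + Complex.I * (Δ : ℂ)).im = z.im + Δ := by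
    intro z u; simp
  have him₂ : ∀ (z : ℂ) (u : ℝ), ((u : ℂ) - Complex.I * (Δ : ℂ) - z).im = -(z.im + Δ) := by
    intro z u; simp; ring
  have hgap : ∀ z ∈ U, 0 < |z.im + Δ| := fun z hz =>
    abs_pos.2 fun h => hz.2 (eq_neg_of_add_eq_zero_left h)
  have hstrip : ∀ z ∈ U, ∀ u : ℝ, |(z - (u : ℂ) + Complex.I * (Δ : ℂ)).im| < ω - ε := by
    intro z hz u
    have hz1 : |z.im| < ω/2 - ε := hz.1
    rw [him₁]
    linarith [abs_add_le z.im Δ, abs_of_pos hΔ]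
  have hne₁ : ∀ z ∈ U, ∀ u : ℝ, z - (u : ℂ) + Complex.I * (Δ : ℂ) ≠ 0 := by
    intro z hz u h
    have := hgap z hz
    rw [← him₁ z u, h] at this
    simp at this
  have hne₂ : ∀ z ∈ U, ∀ u : ℝ, (u : ℂ) - Complex.I * (Δ : ℂ) - z ≠ 0 := by
    intro z hz u h
    have := hgap z hz
    rw [← abs_neg, ← him₂ z u, h] at this
    simp at this
  have hFdiff : ∀ z ∈ U, ∀ u : ℝ,
      DifferentiableAt ℂ (FwC w) (z - (u : ℂ) + Complex.I * (Δ : ℂ)) := fun z hz u =>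
    hF.differentiableAt ((isOpen_abs_im_lt _).mem_nhds (hstrip z hz u))
  have hnhds : ∀ z ∈ U, U ∩ {y : ℂ | |z.im + Δ| / 2 < |y.im + Δ|} ∈ nhds z := fun z hz =>
    Filter.inter_mem (hU.mem_nhds hz)
      ((isOpen_lt continuous_const (by fun_prop)).mem_nhds (half_lt_self (hgap z hz)))
  have hmeas : ∀ lam ∈ U, ∀ mu ∈ U, AEStronglyMeasurable (fun u : ℝ =>
      Complex.exp (-Complex.I * psiC n ((u:ℂ) - Complex.I * (Δ:ℂ)) ((t:ℝ):ℂ)) *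
        FwC w (lam - (u:ℂ) + Complex.I * (Δ:ℂ)) /
        ((lam - (u:ℂ) + Complex.I * (Δ:ℂ)) * ((u:ℂ) - Complex.I * (Δ:ℂ) - mu))) := by
    intro lam hlam mu hmu
    have hFc : Continuous fun u : ℝ => FwC w (lam - (u:ℂ) + Complex.I * (Δ:ℂ)) :=
      continuous_iff_continuousAt.2 fun u =>
        ContinuousAt.comp (g := FwC w) (hFdiff lam hlam u).continuousAt
          (by fun_prop : Continuous fun u : ℝ => lam - (u:ℂ) + Complex.I * (Δ:ℂ)).continuousAt
    have hden : Continuous fun u : ℝ =>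
        ((lam - (u:ℂ) + Complex.I * (Δ:ℂ)) * ((u:ℂ) - Complex.I * (Δ:ℂ) - mu))⁻¹ :=
      Continuous.inv₀ (by fun_prop) fun u => mul_ne_zero (hne₁ lam hlam u) (hne₂ mu hmu u)
    simp only [div_eq_mul_inv]
    exact (hE.aestronglyMeasurable.mul hFc.aestronglyMeasurable).mul hden.aestronglyMeasurable
  refine ⟨fun mu hmu => ?_, fun lam hlam => ?_⟩
  · refine DifferentiableOn.mul (by unfold psiC; fun_prop)
      (differentiableOn_integral_of_locally_dominated hU (fun lam hlam => hmeas lam hlam mu hmu)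
        (fun u lam hlam => ?_) fun lam₀ hlam₀ => ⟨_, hnhds lam₀ hlam₀, _,
          hE.norm.mul_const (C / (|lam₀.im + Δ| / 2 * |mu.im + Δ|)), fun lam hlam u => ?_⟩)
    · have hden : DifferentiableAt ℂ (fun lam =>
          (lam - (u:ℂ) + Complex.I * (Δ:ℂ)) * ((u:ℂ) - Complex.I * (Δ:ℂ) - mu)) lam := by fun_prop
      have hcomp : DifferentiableAt ℂ (fun lam => FwC w (lam - (u:ℂ) + Complex.I * (Δ:ℂ))) lam :=
        DifferentiableAt.comp (g := FwC w) lam (hFdiff lam hlam u) (by fun_prop)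
      exact ((hcomp.const_mul _).fun_div hden
        (mul_ne_zero (hne₁ lam hlam u) (hne₂ mu hmu u))).differentiableWithinAt
    · refine norm_Jker_integrand_le (half_pos (hgap _ hlam₀)) (hgap mu hmu)
        (hFle _ (hstrip lam hlam.1 u).le) ?_ ?_
      · rw [him₁]; exact le_of_lt hlam.2
      · rw [him₂, abs_neg]
  · refine DifferentiableOn.mul (by unfold psiC; fun_prop)
      (differentiableOn_integral_of_locally_dominated hU (fun mu hmu => hmeas lam hlam mu hmu)
        (fun u mu hmu => ?_) fun mu₀ hmu₀ => ⟨_, hnhds mu₀ hmu₀, _,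
          hE.norm.mul_const (C / (|lam.im + Δ| * (|mu₀.im + Δ| / 2))), fun mu hmu u => ?_⟩)
    · have hden : DifferentiableAt ℂ (fun mu =>
          (lam - (u:ℂ) + Complex.I * (Δ:ℂ)) * ((u:ℂ) - Complex.I * (Δ:ℂ) - mu)) mu := by fun_prop
      exact ((differentiableAt_const _).fun_div hden
        (mul_ne_zero (hne₁ lam hlam u) (hne₂ mu hmu u))).differentiableWithinAt
    · refine norm_Jker_integrand_le (hgap lam hlam) (half_pos (hgap _ hmu₀))
        (hFle _ (hstrip lam hlam u).le) ?_ ?_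
      · rw [him₁]
      · rw [him₂, abs_neg]; exact le_of_lt hmu.2
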